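/- Let S₁, …, S_k be pairwise orthogonal subspaces of a real inner product space (i.e., ⟪u, v⟫ = 0 whenever u ∈ S_i, v ∈ S_j with i ≠ j). Let x₁ = Σ_{i=1}^k a_i ≠ 0 and x₂ = Σ_{i=1}^k b_i ≠ 0 with a_i, b_i ∈ S_i for each i, and suppose ⟪a_i, b_i⟫ = ‖a_i‖·‖b_i‖ for every i. Then cos(x₁, x₂) ≤ 1, and cos(x₁, x₂) = 1 if and only if the sequences of component norms are proportional, i.e., there exists c > 0 such that ‖b_i‖ = c·‖a_i‖ for all i. -/

import Mathlib

open scoped RealInnerProductSpace BigOperators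

/-- Cosine similarity of two vectors in a real inner product space. -/
noncomputable def cosSim {E : Type*} [NormedAddCommGroup E] [InnerProductSpace ℝ E]
    (u v : E) : ℝ := ⟪u, v⟫ / (‖u‖ * ‖v‖)

/-- Vectors taken from pairwise orthogonal subspaces all vanish once their sum does. -/
theorem eq_zero_of_sum_eq_zero_of_orthogonal {ι E : Type*} [Fintype ι]
    [NormedAddCommGroup E] [InnerProductSpace ℝ E] (S : ι → Submodule ℝ E)
    (hortho : ∀ i j : ι, i ≠ j → ∀ u ∈ S i, ∀ v ∈ S j, ⟪u, v⟫ = 0)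
    (d : ι → E) (hd : ∀ i, d i ∈ S i) (hsum : ∑ i, d i = 0) (i : ι) : d i = 0 := by
  have h : ⟪d i, ∑ j, d j⟫ = ⟪d i, d i⟫ := by
    rw [inner_sum]
    exact Fintype.sum_eq_single i fun j hj => hortho i j hj.symm _ (hd i) _ (hd j)
  rw [hsum, inner_zero_right] at h
  exact inner_self_eq_zero.mp h.symm

/-- For vectors attaining equality in Cauchy–Schwarz, a ratio of norms is a ratio of vectors. -/
theorem eq_smul_of_inner_eq_norm_mul_of_norm_eq {E : Type*}
    [NormedAddCommGroup E] [InnerProductSpace ℝ E] {u v : E} {c : ℝ}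
    (h : ⟪u, v⟫ = ‖u‖ * ‖v‖) (hc : ‖v‖ = c * ‖u‖) : v = c • u := by
  by_cases hu : u = 0
  · simpa [hu] using hc
  · have hsmul := inner_eq_norm_mul_iff_real.mp h
    rw [hc, mul_comm, mul_smul] at hsmul
    exact (smul_right_injective E (norm_ne_zero_iff.mpr hu) hsmul).symm

/-- Sharp version of Lemma 3: under perfect per-subspace cosine similarity of the
components, the cosine similarity of the sums is at most 1, with equality exactly
when the component norm sequences are proportional. -/
theorem cos_sim_unioned_subspace_sharp
    {E : Type*} [NormedAddCommGroup E] [InnerProductSpace ℝ E]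
    (k : ℕ) (S : Fin k → Submodule ℝ E)
    (hortho : ∀ i j : Fin k, i ≠ j → ∀ u ∈ S i, ∀ v ∈ S j, ⟪u, v⟫ = 0)
    (a b : Fin k → E) (ha : ∀ i, a i ∈ S i) (hb : ∀ i, b i ∈ S i)
    (hcos : ∀ i, ⟪a i, b i⟫ = ‖a i‖ * ‖b i‖)
    (x₁ x₂ : E) (hx₁ : x₁ = ∑ i, a i) (hx₂ : x₂ = ∑ i, b i)
    (hx₁0 : x₁ ≠ 0) (hx₂0 : x₂ ≠ 0) :
    cosSim x₁ x₂ ≤ 1 ∧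
    (cosSim x₁ x₂ = 1 ↔ ∃ c : ℝ, 0 < c ∧ ∀ i, ‖b i‖ = c * ‖a i‖) := by
  refine ⟨(abs_le.mp (abs_real_inner_div_norm_mul_norm_le_one x₁ x₂)).2, ?_⟩
  rw [cosSim, real_inner_div_norm_mul_norm_eq_one_iff]
  constructor
  · rintro ⟨-, c, hc, h⟩
    refine ⟨c, hc, fun i => ?_⟩
    have hi : b i - c • a i = 0 :=
      eq_zero_of_sum_eq_zero_of_orthogonal S hortho (fun j => b j - c • a j)
        (fun j => (S j).sub_mem (hb j) ((S j).smul_mem c (ha j)))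
        (by rw [Finset.sum_sub_distrib, ← Finset.smul_sum, ← hx₁, ← hx₂, h, sub_self]) i
    rw [sub_eq_zero.mp hi, norm_smul, Real.norm_of_nonneg hc.le]
  · rintro ⟨c, hc, h⟩
    refine ⟨hx₁0, c, hc, ?_⟩
    rw [hx₁, hx₂, Finset.smul_sum]
    exact Finset.sum_congr rfl fun i _ =>
      eq_smul_of_inner_eq_norm_mul_of_norm_eq (hcos i) (h i)
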